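/- For every n ≥ 1 with n ≠ 5, the maximum number ν(K_n) of pairwise edge-disjoint triangles in the complete graph K_n satisfies ν(K_n) ≥ (1/3)·(C(n,2) − n/2 − 1). -/

import Mathlib

open Finset SimpleGraph

/-- A triangle packing of a graph `G`: a finite set of triangles (3-cliques) of `G`
that are pairwise edge-disjoint (any two distinct triangles share at most one vertex). -/
def IsTrianglePacking {V : Type*} [DecidableEq V] (G : SimpleGraph V)
    (P : Finset (Finset V)) : Prop :=
  (∀ t ∈ P, G.IsNClique 3 t) ∧
    ∀ t₁ ∈ P, ∀ t₂ ∈ P, t₁ ≠ t₂ → (t₁ ∩ t₂).card ≤ 1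

/-- `nu G` is the maximum cardinality of a triangle packing of `G`. -/
noncomputable def nu {V : Type*} [Fintype V] [DecidableEq V] (G : SimpleGraph V) : ℕ :=
  sSup {n | ∃ P : Finset (Finset V), IsTrianglePacking G P ∧ P.card = n}

/-- A triangle hitting set of `G`: a set of edges of `G` whose removal
results in a triangle-free graph. -/
def IsTriangleHitting {V : Type*} (G : SimpleGraph V) (T : Finset (Sym2 V)) : Prop :=
  ↑T ⊆ G.edgeSet ∧ (G.deleteEdges ↑T).CliqueFree 3

/-- `tau G` is the minimum cardinality of a triangle hitting set of `G`. -/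
noncomputable def tau {V : Type*} [Fintype V] [DecidableEq V] (G : SimpleGraph V) : ℕ :=
  sInf {n | ∃ T : Finset (Sym2 V), IsTriangleHitting G T ∧ T.card = n}

theorem IsTrianglePacking.card_le_nu {V : Type*} [Fintype V] [DecidableEq V]
    {G : SimpleGraph V} {P : Finset (Finset V)} (hP : IsTrianglePacking G P) :
    P.card ≤ nu G :=
  le_csSup ⟨Fintype.card (Finset V), by rintro _ ⟨Q, -, rfl⟩; exact card_le_univ Q⟩ ⟨P, hP, rfl⟩

theorem isTrianglePacking_top_iff {V : Type*} [DecidableEq V] {P : Finset (Finset V)} :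
    IsTrianglePacking (⊤ : SimpleGraph V) P ↔ (∀ t ∈ P, t.card = 3) ∧
      ∀ t₁ ∈ P, ∀ t₂ ∈ P, t₁ ≠ t₂ → (t₁ ∩ t₂).card ≤ 1 := by
  simp [IsTrianglePacking, isNClique_iff, IsClique, Set.Pairwise]

/-- A packing whose triangles lie in the range of an embedding pulls back along it. -/
theorem IsTrianglePacking.card_le_nu_of_embedding {V W : Type*} [DecidableEq V] [Fintype W]
    [DecidableEq W] {P : Finset (Finset V)} (hP : IsTrianglePacking (⊤ : SimpleGraph V) P)
    (e : W ↪ V) (he : ∀ t ∈ P, ∀ v ∈ t, v ∈ Set.range e) :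
    P.card ≤ nu (⊤ : SimpleGraph W) := by
  rw [isTrianglePacking_top_iff] at hP
  have hQ : IsTrianglePacking (⊤ : SimpleGraph W) (univ.filter fun t => t.map e ∈ P) := by
    rw [isTrianglePacking_top_iff]
    refine ⟨fun t ht => ?_, fun t₁ h₁ t₂ h₂ hne => ?_⟩
    · simpa using hP.1 _ (mem_filter.1 ht).2
    · have := hP.2 _ (mem_filter.1 h₁).2 _ (mem_filter.1 h₂).2 (by simpa using hne)
      rwa [← map_inter, card_map] at this
  refine le_trans ?_ hQ.card_le_nu
  have hsub : P ⊆ (univ.filter fun t : Finset W => t.map e ∈ P).image (fun t => t.map e) := by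
    intro t ht
    have : (t.preimage e e.injective.injOn).map e = t := by
      ext v
      simp only [mem_map, mem_preimage]
      exact ⟨by rintro ⟨w, hw, rfl⟩; exact hw, fun hv => by
        obtain ⟨w, rfl⟩ := he t ht v hv
        exact ⟨w, hv, rfl⟩⟩
    exact mem_image.2 ⟨t.preimage e e.injective.injOn, by simp [this, ht], this⟩
  exact (card_le_card hsub).trans card_image_le

theorem exists_isTrianglePacking_card_eq_nu {V : Type*} [Fintype V] [DecidableEq V]
    (G : SimpleGraph V) : ∃ P : Finset (Finset V), IsTrianglePacking G P ∧ P.card = nu G :=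
  Nat.sSup_mem (s := {n | ∃ P : Finset (Finset V), IsTrianglePacking G P ∧ P.card = n})
    ⟨0, ∅, by simp [IsTrianglePacking], rfl⟩
    ⟨Fintype.card (Finset V), by rintro _ ⟨Q, -, rfl⟩; exact card_le_univ Q⟩

/-- Deleting a vertex lying in the fewest triangles of an optimal packing. -/
theorem nu_completeGraph_succ_le (n : ℕ) :
    nu (⊤ : SimpleGraph (Fin (n + 1))) ≤
      nu (⊤ : SimpleGraph (Fin n)) + 3 * nu (⊤ : SimpleGraph (Fin (n + 1))) / (n + 1) := by
  obtain ⟨P, hP, hcard⟩ := exists_isTrianglePacking_card_eq_nu (⊤ : SimpleGraph (Fin (n + 1)))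
  have hsum : ∑ v : Fin (n + 1), (P.filter fun t => v ∈ t).card = 3 * P.card := by
    have h := sum_card_bipartiteAbove_eq_sum_card_bipartiteBelow
      (s := (univ : Finset (Fin (n + 1)))) (t := P) (fun v t => v ∈ t)
    simp only [bipartiteAbove, bipartiteBelow, filter_univ_mem] at h
    rw [h, sum_congr rfl (isTrianglePacking_top_iff.1 hP).1]
    simp [mul_comm]
  obtain ⟨v, hv⟩ : ∃ v : Fin (n + 1), (P.filter fun t => v ∈ t).card ≤ 3 * P.card / (n + 1) := by
    by_contra! h
    have h' : ∑ v : Fin (n + 1), (3 * P.card / (n + 1) + 1) ≤ 3 * P.card :=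
      (sum_le_sum fun v _ => h v).trans hsum.le
    simp only [sum_const, card_univ, Fintype.card_fin, smul_eq_mul] at h'
    have := Nat.lt_mul_div_succ (3 * P.card) (Nat.succ_pos n)
    simp only [Nat.succ_eq_add_one] at this
    omega
  have hQ : IsTrianglePacking (⊤ : SimpleGraph (Fin (n + 1))) (P.filter fun t => v ∉ t) :=
    ⟨fun t ht => hP.1 t (mem_filter.1 ht).1, fun t₁ h₁ t₂ h₂ =>
      hP.2 t₁ (mem_filter.1 h₁).1 t₂ (mem_filter.1 h₂).1⟩
  have hle := hQ.card_le_nu_of_embedding v.succAboveEmb fun t ht w hw => by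
    have hne : w ≠ v := fun h => (mem_filter.1 ht).2 (h ▸ hw)
    simpa using hne
  have := card_filter_add_card_filter_not (s := P) (fun t => v ∈ t)
  rw [← hcard]
  omega

/-- A totally symmetric partial operation, given by its graph `R`, yields a triangle packing
covering every pair on which the operation is defined. -/
theorem card_le_six_mul_nu_of_rel {V : Type*} [Fintype V] [DecidableEq V] (R : V → V → V → Prop)
    (swap : ∀ p q r, R p q r → R q p r) (rot : ∀ p q r, R p q r → R q r p)
    (ne : ∀ p q r, R p q r → p ≠ q) (uniq : ∀ p q r s, R p q r → R p q s → r = s)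
    (S : Finset (V × V)) (hS : ∀ p ∈ S, ∃ r, R p.1 p.2 r) {n : ℕ} (hn : Fintype.card V = n) :
    S.card ≤ 6 * nu (⊤ : SimpleGraph (Fin n)) := by
  classical
  let P : Finset (Finset V) := univ.filter fun t => ∃ p q r, R p q r ∧ t = {p, q, r}
  have hmem (t) : t ∈ P ↔ ∃ p q r, R p q r ∧ t = {p, q, r} := by simp [P]
  have hthird : ∀ t ∈ P, ∀ u ∈ t, ∀ v ∈ t, u ≠ v → ∃ w, R u v w ∧ t = {u, v, w} := by
    intro t ht u hu v hv huv
    obtain ⟨p, q, r, h, rfl⟩ := (hmem t).1 ht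
    have h₁ := rot _ _ _ h
    have h₂ := rot _ _ _ h₁
    simp only [mem_insert, mem_singleton] at hu hv
    rcases hu with rfl | rfl | rfl <;> rcases hv with rfl | rfl | rfl <;>
      first
      | exact absurd rfl huv
      | exact ⟨_, h, by ext; simp; try tauto⟩
      | exact ⟨_, h₁, by ext; simp; try tauto⟩
      | exact ⟨_, h₂, by ext; simp; try tauto⟩
      | exact ⟨_, swap _ _ _ h, by ext; simp; try tauto⟩
      | exact ⟨_, swap _ _ _ h₁, by ext; simp; try tauto⟩
      | exact ⟨_, swap _ _ _ h₂, by ext; simp; try tauto⟩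
  have hcard : ∀ t ∈ P, t.card = 3 := by
    intro t ht
    obtain ⟨p, q, r, h, rfl⟩ := (hmem t).1 ht
    have h₁ := rot _ _ _ h
    exact card_eq_three.2 ⟨p, q, r, ne _ _ _ h, (ne _ _ _ (rot _ _ _ h₁)).symm, ne _ _ _ h₁, rfl⟩
  have hP : IsTrianglePacking (⊤ : SimpleGraph V) P := by
    refine isTrianglePacking_top_iff.2 ⟨hcard, fun t₁ h₁ t₂ h₂ hne => ?_⟩
    by_contra! hlt
    obtain ⟨u, hu, v, hv, huv⟩ := one_lt_card.1 hlt
    rw [mem_inter] at hu hv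
    obtain ⟨w₁, hw₁, rfl⟩ := hthird t₁ h₁ u hu.1 v hv.1 huv
    obtain ⟨w₂, hw₂, rfl⟩ := hthird t₂ h₂ u hu.2 v hv.2 huv
    exact hne (by rw [uniq _ _ _ _ hw₁ hw₂])
  have hsub : S ⊆ P.biUnion fun t => t.offDiag := by
    intro p hp
    obtain ⟨r, hr⟩ := hS p hp
    exact mem_biUnion.2 ⟨{p.1, p.2, r}, (hmem _).2 ⟨_, _, _, hr, rfl⟩,
      mem_offDiag.2 ⟨by simp, by simp, ne _ _ _ hr⟩⟩
  have hle : S.card ≤ P.card * 6 := (card_le_card hsub).trans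
    (card_biUnion_le_card_mul _ _ _ fun t ht => by simp [offDiag_card, hcard t ht])
  have := hP.card_le_nu_of_embedding (Fintype.equivFinOfCardEq hn).symm.toEmbedding
    fun t _ v _ => ⟨Fintype.equivFinOfCardEq hn v, by simp⟩
  omega

/-- The edge from level `i` to level `i + 1` that joins `x` to its square under `op i`. -/
def IsVertical {Q : Type*} (op : Fin 3 → Q → Q → Q) (p q : Q × Fin 3) : Prop :=
  q.2 = p.2 + 1 ∧ op p.2 p.1 p.1 = q.1

/-- The triangle on two points of one level and their product on the next level. -/
def IsMixed {Q : Type*} (op : Fin 3 → Q → Q → Q) (p q r : Q × Fin 3) : Prop :=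
  p.2 = q.2 ∧ r.2 = p.2 + 1 ∧ p.1 ≠ q.1 ∧ op p.2 p.1 q.1 = r.1

/-- The pairs covered by no mixed triangle. -/
def IsResidual {Q I : Type*} (op : Fin 3 → Q → Q → Q) : (Q × Fin 3) ⊕ I → (Q × Fin 3) ⊕ I → Prop
  | .inl p, .inl q => IsVertical op p q ∨ IsVertical op q p
  | _, _ => True

/-- The closure of a ternary relation under permutations of its arguments. -/
def SymmClosure {V : Type*} (C : V → V → V → Prop) (p q r : V) : Prop :=
  C p q r ∨ C q r p ∨ C r p q ∨ C q p r ∨ C p r q ∨ C r q p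

/-- Mixed and residual triangles, put together. -/
def BoseRel {Q I : Type*} (op : Fin 3 → Q → Q → Q)
    (C : (Q × Fin 3) ⊕ I → (Q × Fin 3) ⊕ I → (Q × Fin 3) ⊕ I → Prop) :
    (Q × Fin 3) ⊕ I → (Q × Fin 3) ⊕ I → (Q × Fin 3) ⊕ I → Prop
  | .inl p, .inl q, .inl r => SymmClosure (IsMixed op) p q r ∨
      SymmClosure C (.inl p) (.inl q) (.inl r)
  | p, q, r => SymmClosure C p q r

theorem fin_three_cases (i j : Fin 3) : j = i ∨ j = i + 1 ∨ i = j + 1 := by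
  decide +revert

theorem fin_three_add_one_ne (i : Fin 3) : i + 1 ≠ i := by
  decide +revert

theorem fin_three_add_two_ne (i : Fin 3) : i + 1 + 1 ≠ i := by
  decide +revert

theorem fin_three_add_three (i : Fin 3) : i + 1 + 1 + 1 = i := by
  decide +revert

/-- The Bose–Skolem construction: mixed triangles of commutative quasigroups, together with a
packing of the residual graph given by oriented triangles `C`. -/
theorem card_le_six_mul_nu_of_residual {Q I : Type*} [Fintype Q] [DecidableEq Q] [Fintype I]
    [DecidableEq I] (op : Fin 3 → Q → Q → Q) (comm : ∀ i x y, op i x y = op i y x)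
    (cancel : ∀ i x y z, op i x y = op i x z → y = z)
    (C : (Q × Fin 3) ⊕ I → (Q × Fin 3) ⊕ I → (Q × Fin 3) ⊕ I → Prop)
    (ne : ∀ p q r, C p q r → p ≠ q ∧ q ≠ r ∧ r ≠ p)
    (res : ∀ p q r, C p q r → IsResidual op p q ∧ IsResidual op q r ∧ IsResidual op r p)
    (uniq : ∀ p q r s, SymmClosure C p q r → SymmClosure C p q s → r = s)
    (S : Finset (((Q × Fin 3) ⊕ I) × ((Q × Fin 3) ⊕ I)))
    (hS : ∀ p ∈ S, p.1 ≠ p.2 ∧ (IsResidual op p.1 p.2 → ∃ r, SymmClosure C p.1 p.2 r))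
    {n : ℕ} (hn : 3 * Fintype.card Q + Fintype.card I = n) :
    S.card ≤ 6 * nu (⊤ : SimpleGraph (Fin n)) := by
  have surj (i x) : Function.Surjective (op i x) :=
    Finite.surjective_of_injective fun y z h => cancel i x y z h
  have hres : ∀ p q r, SymmClosure C p q r → IsResidual op p q := by
    intro p q r h
    have hsymm : ∀ p q : (Q × Fin 3) ⊕ I, IsResidual op p q → IsResidual op q p := by
      rintro (p | p) (q | q) h
      · exact h.symm
      all_goals trivial
    rcases h with h | h | h | h | h | h <;> have := res _ _ _ h <;> grind
  have hmix : ∀ p q r, SymmClosure (IsMixed op) p q r →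
      ¬ (IsVertical op p q ∨ IsVertical op q p) := by
    simp only [SymmClosure, IsMixed, IsVertical]
    grind [fin_three_add_one_ne, fin_three_add_two_ne]
  refine card_le_six_mul_nu_of_rel (BoseRel op C) ?_ ?_ ?_ ?_ S ?_ (by simpa [mul_comm] using hn)
  · rintro (p | p) (q | q) (r | r) h <;> simp only [BoseRel, SymmClosure] at * <;> tauto
  · rintro (p | p) (q | q) (r | r) h <;> simp only [BoseRel, SymmClosure] at * <;> tauto
  · have hC : ∀ p q r, SymmClosure C p q r → p ≠ q := by
      intro p q r h
      rcases h with h | h | h | h | h | h <;> have := ne _ _ _ h <;> grind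
    rintro (p | p) (q | q) (r | r) h
    · rcases h with h | h
      · intro hpq
        obtain rfl := Sum.inl_injective hpq
        simp only [SymmClosure, IsMixed] at h
        grind [fin_three_add_one_ne, fin_three_add_two_ne]
      · exact hC _ _ _ h
    all_goals exact hC _ _ _ h
  · have huniq : ∀ p q r s, SymmClosure (IsMixed op) p q r → SymmClosure (IsMixed op) p q s →
        r = s := by
      simp only [SymmClosure, IsMixed]
      rintro ⟨x, i⟩ ⟨y, j⟩ ⟨z, k⟩ ⟨w, l⟩ h₁ h₂
      grind [fin_three_add_one_ne, fin_three_add_two_ne]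
    rintro (p | p) (q | q) (r | r) (s | s) h₁ h₂ <;>
      try exact uniq _ _ _ _ h₁ h₂
    · rcases h₁ with h₁ | h₁ <;> rcases h₂ with h₂ | h₂
      · rw [huniq _ _ _ _ h₁ h₂]
      · exact absurd (hres _ _ _ h₂) (hmix _ _ _ h₁)
      · exact absurd (hres _ _ _ h₁) (hmix _ _ _ h₂)
      · exact uniq _ _ _ _ h₁ h₂
    · rcases h₁ with h₁ | h₁
      · exact absurd (hres _ _ _ h₂) (hmix _ _ _ h₁)
      · exact uniq _ _ _ _ h₁ h₂
    · rcases h₂ with h₂ | h₂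
      · exact absurd (hres _ _ _ h₁) (hmix _ _ _ h₂)
      · exact uniq _ _ _ _ h₁ h₂
  · have key : ∀ p q, p ≠ q → ¬ IsResidual (I := I) op (.inl p) (.inl q) →
        ∃ r, SymmClosure (IsMixed op) p q r := by
      rintro ⟨x, i⟩ ⟨y, j⟩ hne h
      simp only [IsResidual, IsVertical, SymmClosure, IsMixed] at h ⊢
      rcases fin_three_cases i j with rfl | rfl | rfl
      · exact ⟨(op j x y, j + 1), by grind⟩
      · obtain ⟨z, hz⟩ := surj i x y
        exact ⟨(z, i), by grind⟩
      · obtain ⟨z, hz⟩ := surj j y x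
        exact ⟨(z, j), by grind⟩
    have hC : ∀ p q r, SymmClosure C p q r → BoseRel op C p q r := by
      rintro (p | p) (q | q) (r | r) h <;> first | exact h | exact Or.inr h
    rintro ⟨p, q⟩ hpq
    obtain ⟨hne, h⟩ := hS _ hpq
    by_cases hr : IsResidual op p q
    · exact (h hr).imp fun r => hC p q r
    · rcases p with p | p <;> rcases q with q | q <;> try exact absurd trivial hr
      obtain ⟨r, hr⟩ := key p q (by rintro rfl; exact hne rfl) hr
      exact ⟨.inl r, .inl hr⟩

theorem card_univ_offDiag {V : Type*} [Fintype V] [DecidableEq V] :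
    (univ : Finset V).offDiag.card = Fintype.card V * (Fintype.card V - 1) := by
  rw [offDiag_card, card_univ, Nat.mul_sub_one]

theorem SymmClosure.exists_swap {V : Type*} {R : V → V → V → Prop} {p q : V}
    (h : ∃ r, SymmClosure R p q r) : ∃ r, SymmClosure R q p r := by
  obtain ⟨r, hr⟩ := h
  exact ⟨r, by simp only [SymmClosure] at *; tauto⟩

/-- The vertical triangles of Bose's construction. -/
def IsVerticalTriangle {Q : Type*} (p q r : Q × Fin 3) : Prop :=
  q.1 = p.1 ∧ r.1 = p.1 ∧ q.2 = p.2 + 1 ∧ r.2 = p.2 + 1 + 1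

/-- Vertical triangles lifted to a vertex set with no point at infinity. -/
def BoseTriangle {Q : Type*} : (Q × Fin 3) ⊕ Empty → (Q × Fin 3) ⊕ Empty →
    (Q × Fin 3) ⊕ Empty → Prop
  | .inl p, .inl q, .inl r => IsVerticalTriangle p q r
  | _, _, _ => False

theorem BoseTriangle.unique {Q : Type*} (p q r s : (Q × Fin 3) ⊕ Empty)
    (h₁ : SymmClosure BoseTriangle p q r) (h₂ : SymmClosure BoseTriangle p q s) : r = s := by
  rcases p with ⟨x, i⟩ | p <;> rcases q with ⟨y, j⟩ | q <;> rcases r with ⟨z, k⟩ | r <;>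
    rcases s with ⟨w, l⟩ | s <;> try contradiction
  simp only [SymmClosure, BoseTriangle, IsVerticalTriangle] at h₁ h₂
  grind [fin_three_add_one_ne, fin_three_add_two_ne, fin_three_add_three]

/-- The residual triangles of Skolem's construction, where `π` is the squaring map. -/
def SkolemTriangle {Q : Type*} (π : Q → Q) : (Q × Fin 3) ⊕ Unit → (Q × Fin 3) ⊕ Unit →
    (Q × Fin 3) ⊕ Unit → Prop
  | .inl p, .inl q, .inl r => π p.1 = p.1 ∧ IsVerticalTriangle p q r
  | .inl p, .inl q, .inr _ => π p.1 ≠ p.1 ∧ q.1 = π p.1 ∧ q.2 = p.2 + 1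
  | _, _, _ => False

theorem SkolemTriangle.unique {Q : Type*} (π : Q → Q) (idem : ∀ x, π (π x) = π x)
    (inj : ∀ x y, π x ≠ x → π y ≠ y → π x = π y → x = y) (p q r s : (Q × Fin 3) ⊕ Unit)
    (h₁ : SymmClosure (SkolemTriangle π) p q r) (h₂ : SymmClosure (SkolemTriangle π) p q s) :
    r = s := by
  rcases p with ⟨x, i⟩ | p <;> rcases q with ⟨y, j⟩ | q <;> rcases r with ⟨z, k⟩ | r <;>
    rcases s with ⟨w, l⟩ | s <;>
    simp only [SymmClosure, SkolemTriangle, IsVerticalTriangle, or_false, false_or] at h₁ h₂ <;>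
    grind (splits := 40) [fin_three_add_one_ne, fin_three_add_two_ne, fin_three_add_three]

/-- The residual triangles when the order is `5` modulo `6`: the twisted vertical edge above
`p` is joined to the point at infinity `ε p.2 p.1`. -/
def TwistedTriangle {Q : Type*} [Zero Q] (τ : Fin 3 → Q → Q) (ε : Fin 3 → Q → Bool) :
    (Q × Fin 3) ⊕ Bool → (Q × Fin 3) ⊕ Bool → (Q × Fin 3) ⊕ Bool → Prop
  | .inl p, .inl q, .inl r => p.1 = 0 ∧ IsVerticalTriangle p q r
  | .inl p, .inl q, .inr b => p.1 ≠ 0 ∧ q.1 = τ p.2 p.1 ∧ q.2 = p.2 + 1 ∧ b = ε p.2 p.1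
  | .inl p, .inr b, .inr c => p.1 = 0 ∧ p.2 = 0 ∧ c = !b
  | _, _, _ => False

theorem TwistedTriangle.unique {Q : Type*} [Zero Q] (τ : Fin 3 → Q → Q) (ε : Fin 3 → Q → Bool)
    (ττ : ∀ i x, τ i (τ i x) = x) (τ0 : ∀ i, τ i 0 = 0)
    (hε : ∀ i x, x ≠ 0 → ε (i + 1) (τ i x) = !ε i x) (p q r s : (Q × Fin 3) ⊕ Bool)
    (h₁ : SymmClosure (TwistedTriangle τ ε) p q r)
    (h₂ : SymmClosure (TwistedTriangle τ ε) p q s) : r = s := by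
  have not_inj : ∀ b c d : Bool, b = (!c) → b = (!d) → c = d := by decide
  have not_comm : ∀ b c : Bool, b = (!c) → c = (!b) := by decide
  have τ_ne : ∀ i x, x ≠ 0 → τ i x ≠ 0 := fun i x hx h => hx (by rw [← ττ i x, h, τ0])
  rcases p with ⟨x, i⟩ | p <;> rcases q with ⟨y, j⟩ | q <;> rcases r with ⟨z, k⟩ | r <;>
    rcases s with ⟨w, l⟩ | s <;>
    simp only [SymmClosure, TwistedTriangle, IsVerticalTriangle, or_false, false_or] at h₁ h₂ <;>
    grind (splits := 40) [fin_three_add_one_ne, fin_three_add_two_ne, fin_three_add_three]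

theorem TwistedTriangle.exists_of_vertical {Q : Type*} [Zero Q] (τ : Fin 3 → Q → Q)
    (ε : Fin 3 → Q → Bool) (τ0 : ∀ i, τ i 0 = 0) (x : Q) (i : Fin 3) :
    ∃ r, SymmClosure (TwistedTriangle τ ε) (.inl (x, i)) (.inl (τ i x, i + 1)) r := by
  by_cases hx : x = 0
  · subst hx
    exact ⟨.inl (0, i + 1 + 1), .inl ⟨rfl, τ0 i, rfl, rfl, rfl⟩⟩
  · exact ⟨.inr (ε i x), .inl ⟨hx, rfl, rfl, rfl⟩⟩

theorem TwistedTriangle.exists_of_infinity {Q : Type*} [Zero Q] (τ : Fin 3 → Q → Q)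
    (ε : Fin 3 → Q → Bool)
    (ττ : ∀ i x, τ i (τ i x) = x) (τ0 : ∀ i, τ i 0 = 0)
    (hε : ∀ i x, x ≠ 0 → ε (i + 1) (τ i x) = !ε i x) (x : Q) (i : Fin 3) (b : Bool)
    (hxi : x ≠ 0 ∨ i = 0) :
    ∃ r, SymmClosure (TwistedTriangle τ ε) (.inl (x, i)) (.inr b) r := by
  have τ_ne : ∀ i x, x ≠ 0 → τ i x ≠ 0 := fun i x hx h => hx (by rw [← ττ i x, h, τ0])
  by_cases hx : x = 0
  · obtain rfl : i = 0 := by tauto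
    subst hx
    exact ⟨.inr !b, .inl ⟨rfl, rfl, rfl⟩⟩
  by_cases hb : ε i x = b
  · exact ⟨.inl (τ i x, i + 1), .inr (.inr (.inr (.inr (.inl
      ⟨hx, rfl, rfl, hb.symm⟩))))⟩
  · have hy := hε (i + 1 + 1) (τ (i + 1 + 1) x) (τ_ne _ _ hx)
    rw [ττ, fin_three_add_three] at hy
    refine ⟨.inl (τ (i + 1 + 1) x, i + 1 + 1), .inr (.inr (.inl
      ⟨τ_ne _ _ hx, (ττ _ _).symm, (fin_three_add_three i).symm, ?_⟩))⟩
    have eq_of_ne : ∀ a b c : Bool, a ≠ b → a = (!c) → b = c := by decide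
    exact eq_of_ne _ _ _ hb hy

/-- Bose's construction of Steiner triple systems. -/
theorem six_mul_nu_bose (k : ℕ) :
    (6 * k + 3) * (6 * k + 2) ≤ 6 * nu (⊤ : SimpleGraph (Fin (6 * k + 3))) := by
  have half : ((k : ZMod (2 * k + 1)) + 1) * 2 = 1 := by
    have := ZMod.natCast_self (2 * k + 1)
    push_cast at this
    linear_combination this
  let op : Fin 3 → ZMod (2 * k + 1) → ZMod (2 * k + 1) → ZMod (2 * k + 1) :=
    fun _ x y => (x + y) * (k + 1)
  have idem : ∀ i x, op i x x = x := fun _ x => by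
    simp only [op]
    linear_combination x * half
  have h := card_le_six_mul_nu_of_residual (I := Empty) op
    (fun i x y => by simp only [op, add_comm])
    (fun i x y z h => by
      simp only [op] at h
      linear_combination 2 * h + (z - y) * half)
    BoseTriangle
    (by
      rintro (⟨x, i⟩ | p) (⟨y, j⟩ | q) (⟨z, k⟩ | r) h <;> try contradiction
      simp only [BoseTriangle, IsVerticalTriangle] at h
      obtain ⟨rfl, rfl, rfl, rfl⟩ := h
      simp [fin_three_add_two_ne])
    (by
      rintro (⟨x, i⟩ | p) (⟨y, j⟩ | q) (⟨z, k⟩ | r) h <;> try contradiction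
      simp only [BoseTriangle, IsVerticalTriangle] at h
      obtain ⟨rfl, rfl, rfl, rfl⟩ := h
      simp [IsResidual, IsVertical, idem, fin_three_add_three])
    BoseTriangle.unique
    univ.offDiag
    (by
      rintro ⟨⟨x, i⟩ | p, ⟨y, j⟩ | q⟩ hp
      · refine ⟨by simpa using hp, fun hr => ?_⟩
        simp only [IsResidual, IsVertical, idem] at hr
        rcases hr with ⟨rfl, rfl⟩ | ⟨rfl, rfl⟩
        · exact ⟨.inl (x, i + 1 + 1), .inl ⟨rfl, rfl, rfl, rfl⟩⟩
        · exact ⟨.inl (y, j + 1 + 1), .inr (.inr (.inr (.inl ⟨rfl, rfl, rfl, rfl⟩)))⟩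
      all_goals contradiction)
    (n := 6 * k + 3) (by simp [ZMod.card]; ring)
  have hcard : Fintype.card ((ZMod (2 * k + 1) × Fin 3) ⊕ Empty) = 6 * k + 3 := by
    simp [ZMod.card]; ring
  rwa [card_univ_offDiag, hcard] at h

/-- The half-idempotent commutative quasigroup of order `2 * k`. -/
def skolemOp (k : ℕ) (x y : Fin (2 * k)) : Fin (2 * k) :=
  let m := if x.val + y.val < 2 * k then x.val + y.val else x.val + y.val - 2 * k
  ⟨if m % 2 = 0 then m / 2 else k + m / 2, by grind⟩

theorem skolemOp_comm (k : ℕ) (x y : Fin (2 * k)) : skolemOp k x y = skolemOp k y x := by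
  simp only [skolemOp, add_comm]

theorem skolemOp_cancel (k : ℕ) (x y z : Fin (2 * k)) (h : skolemOp k x y = skolemOp k x z) :
    y = z := by
  simp only [skolemOp, Fin.mk.injEq] at h
  ext
  grind

theorem skolemOp_self_val (k : ℕ) (x : Fin (2 * k)) :
    (skolemOp k x x).val = if x.val < k then x.val else x.val - k := by
  simp only [skolemOp]
  grind

/-- Skolem's construction of Steiner triple systems. -/
theorem six_mul_nu_skolem (k : ℕ) :
    (6 * k + 1) * (6 * k) ≤ 6 * nu (⊤ : SimpleGraph (Fin (6 * k + 1))) := by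
  let π : Fin (2 * k) → Fin (2 * k) := fun x => skolemOp k x x
  have hπ : ∀ x, (π x).val = if x.val < k then x.val else x.val - k := skolemOp_self_val k
  have idem : ∀ x, π (π x) = π x := fun x => by ext; grind
  have inj : ∀ x y, π x ≠ x → π y ≠ y → π x = π y → x = y := fun x y hx hy h => by
    simp only [ne_eq, Fin.ext_iff, hπ] at *
    grind
  have pre : ∀ x, π x = x → ∃ y, y ≠ x ∧ π y = x := fun x hx => by
    simp only [ne_eq, Fin.ext_iff, hπ] at *
    exact ⟨⟨x.val + k, by grind⟩, by grind, by grind⟩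
  have h := card_le_six_mul_nu_of_residual (fun _ => skolemOp k)
    (fun _ => skolemOp_comm k) (fun _ => skolemOp_cancel k)
    (SkolemTriangle π)
    (by
      rintro (⟨x, i⟩ | p) (⟨y, j⟩ | q) (⟨z, l⟩ | r) h <;> try contradiction
      · simp only [SkolemTriangle, IsVerticalTriangle] at h
        obtain ⟨-, rfl, rfl, rfl, rfl⟩ := h
        simp [fin_three_add_two_ne]
      · obtain ⟨-, rfl, rfl⟩ := h
        simp)
    (by
      rintro (⟨x, i⟩ | p) (⟨y, j⟩ | q) (⟨z, l⟩ | r) h <;> try contradiction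
      · simp only [SkolemTriangle, IsVerticalTriangle] at h
        obtain ⟨hx, rfl, rfl, rfl, rfl⟩ := h
        simp only [π] at hx
        simp [IsResidual, IsVertical, hx, fin_three_add_three]
      · obtain ⟨-, rfl, rfl⟩ := h
        simp [IsResidual, IsVertical, π])
    (SkolemTriangle.unique π idem inj)
    univ.offDiag
    (by
      have hinf : ∀ x i, ∃ r, SymmClosure (SkolemTriangle π) (.inl (x, i)) (.inr ()) r :=
          fun x i => by
        by_cases hx : π x = x
        · obtain ⟨y, hy, hyx⟩ := pre x hx
          exact ⟨.inl (y, i + 1 + 1), .inr (.inr (.inl ⟨hyx.trans_ne hy.symm, hyx.symm,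
            (fin_three_add_three i).symm⟩))⟩
        · exact ⟨.inl (π x, i + 1), .inr (.inr (.inr (.inr (.inl ⟨hx, rfl, rfl⟩))))⟩
      have hver : ∀ x i, ∃ r, SymmClosure (SkolemTriangle π) (.inl (x, i)) (.inl (π x, i + 1)) r :=
          fun x i => by
        by_cases hx : π x = x
        · exact ⟨.inl (x, i + 1 + 1), .inl ⟨hx, hx, rfl, rfl, rfl⟩⟩
        · exact ⟨.inr (), .inl ⟨hx, rfl, rfl⟩⟩
      rintro ⟨⟨x, i⟩ | ⟨⟩, ⟨y, j⟩ | ⟨⟩⟩ hp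
      · refine ⟨by simpa using hp, fun hr => ?_⟩
        rcases hr with ⟨hi, hx⟩ | ⟨hi, hx⟩
        · obtain rfl : j = i + 1 := hi
          obtain rfl : π x = y := hx
          exact hver x i
        · obtain rfl : i = j + 1 := hi
          obtain rfl : π y = x := hx
          exact SymmClosure.exists_swap (hver y j)
      · exact ⟨by simp, fun _ => hinf x i⟩
      · exact ⟨by simp, fun _ => SymmClosure.exists_swap (hinf y j)⟩
      · simp at hp)
    (n := 6 * k + 1) (by simp; ring)
  have hcard : Fintype.card ((Fin (2 * k) × Fin 3) ⊕ Unit) = 6 * k + 1 := by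
    simp; ring
  rwa [card_univ_offDiag, hcard] at h

set_option maxHeartbeats 600000 in
/-- A maximum packing when the order is `5` modulo `6`: all edges but a `4`-cycle are covered. -/
theorem six_mul_nu_five_mod_six (k : ℕ) :
    (6 * k + 5) * (6 * k + 4) - 8 ≤ 6 * nu (⊤ : SimpleGraph (Fin (6 * k + 5))) := by
  have half : ((k : ZMod (2 * k + 1)) + 1) * 2 = 1 := by
    have := ZMod.natCast_self (2 * k + 1)
    push_cast at this
    linear_combination this
  let τ : Fin 3 → ZMod (2 * k + 1) → ZMod (2 * k + 1) := fun i x => if i = 2 then -x else x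
  have ττ : ∀ i x, τ i (τ i x) = x := fun i x => by simp only [τ]; split_ifs <;> simp
  have τ0 : ∀ i, τ i 0 = 0 := fun i => by simp [τ]
  let op : Fin 3 → ZMod (2 * k + 1) → ZMod (2 * k + 1) → ZMod (2 * k + 1) :=
    fun i x y => τ i ((x + y) * (k + 1))
  have op_self : ∀ i x, op i x x = τ i x := fun i x => by
    simp only [op]
    congr 1
    linear_combination x * half
  -- The residual edge above `(x, i)` is joined to the point at infinity `ε i x`.
  let ε : Fin 3 → ZMod (2 * k + 1) → Bool := fun i x => xor (decide (x.val ≤ k)) (decide (i = 1))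
  have hε : ∀ i x, x ≠ 0 → ε (i + 1) (τ i x) = !ε i x := fun i x hx => by
    have hneg : decide ((-x).val ≤ k) = !decide (x.val ≤ k) := by
      have := ZMod.val_lt x
      have : NeZero x := ⟨hx⟩
      rw [ZMod.val_neg_of_ne_zero, ← decide_not, decide_eq_decide]
      omega
    fin_cases i <;> simp [ε, τ, hneg]
  let T : Finset (((ZMod (2 * k + 1) × Fin 3) ⊕ Bool) × ((ZMod (2 * k + 1) × Fin 3) ⊕ Bool)) :=
    ({.inl (0, 1), .inl (0, 2)} ×ˢ {.inr true, .inr false}) ∪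
      ({.inr true, .inr false} ×ˢ {.inl (0, 1), .inl (0, 2)})
  have ne_zero : ∀ i : Fin 3, i ≠ 0 → i = 1 ∨ i = 2 := by decide
  have hT : T.card ≤ 8 := by
    refine (card_union_le _ _).trans ?_
    simp [card_product]
  have h := card_le_six_mul_nu_of_residual op
    (fun i x y => by simp only [op, add_comm])
    (fun i x y z h => by
      simp only [op] at h
      have h' := congrArg (τ i) h
      rw [ττ, ττ] at h'
      linear_combination 2 * h' + (z - y) * half)
    (TwistedTriangle τ ε)
    (by
      rintro (⟨x, i⟩ | b) (⟨y, j⟩ | c) (⟨z, l⟩ | d) h <;> try contradiction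
      · simp only [TwistedTriangle, IsVerticalTriangle] at h
        obtain ⟨-, rfl, rfl, rfl, rfl⟩ := h
        simp [fin_three_add_two_ne]
      · obtain ⟨-, rfl, rfl, rfl⟩ := h
        simp
      · obtain ⟨rfl, rfl, rfl⟩ := h
        simp)
    (by
      rintro (⟨x, i⟩ | b) (⟨y, j⟩ | c) (⟨z, l⟩ | d) h <;> try contradiction
      · simp only [TwistedTriangle, IsVerticalTriangle] at h
        obtain ⟨rfl, rfl, rfl, rfl, rfl⟩ := h
        simp [IsResidual, IsVertical, op_self, τ0, fin_three_add_three]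
      · obtain ⟨-, rfl, rfl, rfl⟩ := h
        simp [IsResidual, IsVertical, op_self]
      · simp [IsResidual])
    (TwistedTriangle.unique τ ε ττ τ0 hε)
    (univ.offDiag \ T)
    (by
      rintro ⟨⟨x, i⟩ | b, ⟨y, j⟩ | c⟩ hp
      · refine ⟨by simpa using (mem_sdiff.1 hp).1, fun hr => ?_⟩
        simp only [IsResidual, IsVertical, op_self] at hr
        rcases hr with ⟨rfl, rfl⟩ | ⟨rfl, rfl⟩
        · exact TwistedTriangle.exists_of_vertical τ ε τ0 x i
        · exact SymmClosure.exists_swap (TwistedTriangle.exists_of_vertical τ ε τ0 y j)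
      · refine ⟨by simp, fun _ => TwistedTriangle.exists_of_infinity τ ε ττ τ0 hε x i c ?_⟩
        by_contra! hx
        obtain ⟨rfl, hi⟩ := hx
        refine (mem_sdiff.1 hp).2 ?_
        rcases ne_zero i hi with rfl | rfl <;> cases c <;> simp [T]
      · refine ⟨by simp, fun _ => SymmClosure.exists_swap
          (TwistedTriangle.exists_of_infinity τ ε ττ τ0 hε y j b ?_)⟩
        by_contra! hx
        obtain ⟨rfl, hi⟩ := hx
        refine (mem_sdiff.1 hp).2 ?_
        rcases ne_zero j hi with rfl | rfl <;> cases b <;> simp [T]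
      · have hbc : b ≠ c := by simpa using (mem_sdiff.1 hp).1
        exact ⟨by simpa using hbc, fun _ => ⟨.inl (0, 0), .inr (.inr (.inl
          ⟨rfl, rfl, by cases b <;> cases c <;> simp_all⟩))⟩⟩)
    (n := 6 * k + 5) (by simp [ZMod.card]; ring)
  have hcard : Fintype.card ((ZMod (2 * k + 1) × Fin 3) ⊕ Bool) = 6 * k + 5 := by
    simp [ZMod.card]; ring
  have hS := le_card_sdiff T univ.offDiag
  rw [card_univ_offDiag, hcard] at hS
  change (6 * k + 5) * (6 * k + 4) - _ ≤ _ at hS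
  omega

/-- Passing from odd order `m + 1`, with up to `c` ordered pairs uncovered, to order `m`. -/
theorem sq_le_six_mul_nu_add (m c : ℕ)
    (h : (m + 1) * m ≤ 6 * nu (⊤ : SimpleGraph (Fin (m + 1))) + c) (hm : 2 ≤ m) :
    (m + 1) * (m * m) + 3 * c ≤ (m + 1) * (6 * nu (⊤ : SimpleGraph (Fin m)) + 2 * m + c) := by
  have hdel := nu_completeGraph_succ_le m
  set N := nu (⊤ : SimpleGraph (Fin (m + 1)))
  have hdiv := Nat.mul_div_le (3 * N) (m + 1)
  have hN : (m + 1) * N ≤ (m + 1) * nu (⊤ : SimpleGraph (Fin m)) + 3 * N :=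
    (Nat.mul_le_mul_left _ hdel).trans (by rw [mul_add]; omega)
  obtain ⟨d, rfl⟩ := Nat.exists_eq_add_of_le hm
  have := Nat.mul_le_mul_left d h
  nlinarith

/-- The bound cleared of denominators. -/
theorem sq_le_six_mul_nu (n : ℕ) (hn : 1 ≤ n) (hn5 : n ≠ 5) :
    n * n ≤ 6 * nu (⊤ : SimpleGraph (Fin n)) + 2 * n + 2 := by
  obtain ⟨k, hk⟩ : ∃ k, n = 6 * k ∨ n = 6 * k + 1 ∨ n = 6 * k + 2 ∨ n = 6 * k + 3 ∨
      n = 6 * k + 4 ∨ n = 6 * k + 5 := ⟨n / 6, by omega⟩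
  rcases hk with rfl | rfl | rfl | rfl | rfl | rfl
  · have h := sq_le_six_mul_nu_add (6 * k) 0 (six_mul_nu_skolem k) (by omega)
    have := Nat.le_of_mul_le_mul_left h (Nat.succ_pos _)
    omega
  · nlinarith [six_mul_nu_skolem k]
  · have h := sq_le_six_mul_nu_add (6 * k + 2) 0 (six_mul_nu_bose k) (by omega)
    have := Nat.le_of_mul_le_mul_left h (Nat.succ_pos _)
    omega
  · nlinarith [six_mul_nu_bose k]
  · have h := sq_le_six_mul_nu_add (6 * k + 4) 8
      (Nat.sub_le_iff_le_add.1 (six_mul_nu_five_mod_six k)) (by omega)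
    have hlt := Nat.lt_of_mul_lt_mul_left
      (lt_of_lt_of_le (Nat.lt_add_of_pos_right (show 0 < 3 * 8 by norm_num)) h)
    have hsq : (6 * k + 4) * (6 * k + 4) = 6 * (6 * (k * k) + 8 * k + 2) + 4 := by ring
    rw [hsq] at hlt ⊢
    omega
  · have h := six_mul_nu_five_mod_six k
    rw [Nat.sub_le_iff_le_add] at h
    have hk : 1 ≤ k := by omega
    nlinarith

/-- For every `n ≥ 1` with `n ≠ 5`, `ν(K_n) ≥ (1/3)(C(n,2) - n/2 - 1)`. -/
theorem nu_completeGraph_ge_ne_five (n : ℕ) (hn : 1 ≤ n) (hn5 : n ≠ 5) :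
    (nu (⊤ : SimpleGraph (Fin n)) : ℝ) ≥
      (1 / 3) * ((n.choose 2 : ℝ) - (n : ℝ) / 2 - 1) := by
  have h : (n * n : ℝ) ≤ 6 * nu (⊤ : SimpleGraph (Fin n)) + 2 * n + 2 := by
    exact_mod_cast sq_le_six_mul_nu n hn hn5
  rw [Nat.cast_choose_two]
  linarith
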